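/- For integers n ≥ 2 and k ≥ 3, define Θ_{n,k} := 1 − t^{n+1} − t^{n+k+1} + t^{2n+k} ∈ ℤ[t], and let S := {Θ_m : m ≥ 2} ∪ {J_{a,b} : a ≥ b ≥ 1} ∪ {J'_{a,b} : a ≥ b ≥ 1} ∪ {J''_{a,b} : a > 1, b ≥ 1}. Then Θ_{n,k} ∈ S if and only if (n,k) = (2,3), in which case Θ_{2,3} = J''_{2,1}. (Θ_{n,k} is the normalized Jones polynomial of the torus knot T(n,n+k); hence for k ≥ 3 the torus knot T(n,n+k) has Hopf crossing number at least 2, except for T(2,5).) -/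

import Mathlib

open Polynomial

/-- Normalized Jones polynomial of the knot `K_{a,b}` (for `a ≥ b ≥ 1`). -/
noncomputable def J (a b : ℕ) : Polynomial ℤ :=
  1 - X - X ^ (a + b + 2) + X ^ (a + b + 3) + X ^ (a * b + 2 * b + 1)
    - X ^ (a * b + a + b + 1) - X ^ (a * b + a + b + 3) + X ^ (a * b + 2 * a + 1)

/-- Normalized Jones polynomial of the knot `K'_{a,b}` (for `a ≥ b ≥ 1`). -/
noncomputable def J' (a b : ℕ) : Polynomial ℤ :=
  -1 + X + X ^ (a + b) - X ^ (a + b + 1) + X ^ (a * b + 2 * b)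
    - X ^ (a * b + a + b) - X ^ (a * b + a + b + 2) + X ^ (a * b + 2 * a)

/-- Normalized Jones polynomial of the knot `K''_{a,b}` (for `a > 1`, `b ≥ 1`). -/
noncomputable def J'' (a b : ℕ) : Polynomial ℤ :=
  1 - X ^ (a + b) - X ^ (a + b + 2) + X ^ (2 * a + 2 * b)
    - X ^ (a * b + a + b + 1) + X ^ (a * b + a + b + 2)
    + X ^ (a * b + 2 * a - 1) - X ^ (a * b + 2 * a)

/-- Normalized Jones polynomial of the torus knot `T(n,n+1)` (for `n ≥ 2`). -/
noncomputable def Θ (n : ℕ) : Polynomial ℤ :=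
  1 - X ^ (n + 1) - X ^ (n + 2) + X ^ (2 * n + 1)

/-- Normalized Jones polynomial of the torus knot `T(n,n+k)`. -/
noncomputable def Θ₂ (n k : ℕ) : Polynomial ℤ :=
  1 - X ^ (n + 1) - X ^ (n + k + 1) + X ^ (2 * n + k)

/-- The set of normalized Jones polynomials of all knots with Hopf crossing
number at most one. -/
def S : Set (Polynomial ℤ) :=
  {P | ∃ m : ℕ, 2 ≤ m ∧ P = Θ m} ∪ {P | ∃ a b : ℕ, 1 ≤ b ∧ b ≤ a ∧ P = J a b} ∪
    {P | ∃ a b : ℕ, 1 ≤ b ∧ b ≤ a ∧ P = J' a b} ∪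
    {P | ∃ a b : ℕ, 1 < a ∧ 1 ≤ b ∧ P = J'' a b}

theorem coeff_Θ₂ (n k i : ℕ) :
    (Θ₂ n k).coeff i = (if i = 0 then 1 else 0) - (if i = n + 1 then 1 else 0)
      - (if i = n + k + 1 then 1 else 0) + (if i = 2 * n + k then 1 else 0) := by
  simp only [Θ₂, coeff_add, coeff_sub, coeff_X_pow, coeff_one]

theorem eq_of_coeff_Θ₂_neg {n k i : ℕ} (h : (Θ₂ n k).coeff i = -1) :
    i = n + 1 ∨ i = n + k + 1 := by
  rw [coeff_Θ₂] at h
  split_ifs at h <;> omega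

theorem Θ₂_two_three : Θ₂ 2 3 = J'' 2 1 := by
  simp only [Θ₂, J'']
  norm_num
  ring

theorem Θ₂_ne_Θ {n k m : ℕ} (hk : 3 ≤ k) (hm : 2 ≤ m) : Θ₂ n k ≠ Θ m := by
  intro h
  have h₁ : (Θ m).coeff (m + 1) = -1 := by
    simp only [Θ, coeff_add, coeff_sub, coeff_X_pow, coeff_one]
    grind
  have h₂ : (Θ m).coeff (m + 2) = -1 := by
    simp only [Θ, coeff_add, coeff_sub, coeff_X_pow, coeff_one]
    grind
  rw [← h] at h₁ h₂
  have := eq_of_coeff_Θ₂_neg h₁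
  have := eq_of_coeff_Θ₂_neg h₂
  omega

theorem Θ₂_ne_J {n k a b : ℕ} (hn : 2 ≤ n) (hb : 1 ≤ b) (hab : b ≤ a) : Θ₂ n k ≠ J a b := by
  intro h
  have h₁ : (J a b).coeff 1 = -1 := by
    simp only [J, coeff_add, coeff_sub, coeff_X_pow, coeff_one, coeff_X]
    grind
  rw [← h] at h₁
  have := eq_of_coeff_Θ₂_neg h₁
  omega

theorem Θ₂_ne_J' {n k a b : ℕ} (hb : 1 ≤ b) (hab : b ≤ a) : Θ₂ n k ≠ J' a b := by
  intro h
  have h₁ : (J' a b).coeff 0 = -1 := by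
    simp only [J', coeff_add, coeff_sub, coeff_neg, coeff_X_pow, coeff_one, coeff_X]
    grind
  rw [← h] at h₁
  have := eq_of_coeff_Θ₂_neg h₁
  omega

theorem eq_of_Θ₂_eq_J'' {n k a b : ℕ} (hk : 3 ≤ k) (ha : 1 < a) (hb : 1 ≤ b)
    (h : Θ₂ n k = J'' a b) : a = 2 ∧ b = 1 := by
  by_contra hne
  have hq : a + b + 4 ≤ a * b + 2 * a := by
    obtain ⟨c, rfl⟩ := Nat.exists_eq_add_of_le ha
    obtain ⟨d, rfl⟩ := Nat.exists_eq_add_of_le hb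
    have : 1 ≤ c + d := by omega
    nlinarith [Nat.zero_le (c * d)]
  have hp : 2 ≤ a * b := by nlinarith
  have h₁ : (J'' a b).coeff (a + b) = -1 := by
    simp only [J'', coeff_add, coeff_sub, coeff_X_pow, coeff_one]
    generalize a * b = r at *
    grind
  have h₂ : (J'' a b).coeff (a + b + 2) = -1 := by
    simp only [J'', coeff_add, coeff_sub, coeff_X_pow, coeff_one]
    generalize a * b = r at *
    grind
  rw [← h] at h₁ h₂
  have := eq_of_coeff_Θ₂_neg h₁
  have := eq_of_coeff_Θ₂_neg h₂
  omega

theorem Θ₂_eq_Θ₂_two_three {n k : ℕ} (hn : 2 ≤ n) (hk : 3 ≤ k) (h : Θ₂ n k = Θ₂ 2 3) :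
    n = 2 ∧ k = 3 := by
  have h₁ : (Θ₂ 2 3).coeff 3 = -1 := by norm_num [coeff_Θ₂]
  have h₂ : (Θ₂ 2 3).coeff 6 = -1 := by norm_num [coeff_Θ₂]
  rw [← h] at h₁ h₂
  have := eq_of_coeff_Θ₂_neg h₁
  have := eq_of_coeff_Θ₂_neg h₂
  omega

/-- for `n ≥ 2`, `k ≥ 3`, the normalized Jones polynomial of `T(n,n+k)`
lies in `S` exactly when `(n,k) = (2,3)`, i.e. for the torus knot `T(2,5)`, in which
case it equals `J''_{2,1}`. -/
theorem stmt_15 (n k : ℕ) (hn : 2 ≤ n) (hk : 3 ≤ k) :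
    (Θ₂ n k ∈ S ↔ n = 2 ∧ k = 3) ∧ Θ₂ 2 3 = J'' 2 1 := by
  refine ⟨⟨?_, ?_⟩, Θ₂_two_three⟩
  · rintro (((⟨m, hm, h⟩ | ⟨a, b, hb, hab, h⟩) | ⟨a, b, hb, hab, h⟩) | ⟨a, b, ha, hb, h⟩)
    · exact absurd h (Θ₂_ne_Θ hk hm)
    · exact absurd h (Θ₂_ne_J hn hb hab)
    · exact absurd h (Θ₂_ne_J' hb hab)
    · obtain ⟨rfl, rfl⟩ := eq_of_Θ₂_eq_J'' hk ha hb h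
      exact Θ₂_eq_Θ₂_two_three hn hk (h.trans Θ₂_two_three.symm)
  · rintro ⟨rfl, rfl⟩
    exact Or.inr ⟨2, 1, by norm_num, le_rfl, Θ₂_two_three⟩
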